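/- arXiv:1307.8426 — 2 statements merged into one kernel-verified Lean document; each statement's English description precedes it below -/
import Mathlib

section
/- Let μ be a Borel measure on ℝ^d and define K(s,ξ) = (sin(s|ξ|)/|ξ|)² for ξ ≠ 0 and K(s,0) = s². Then the following are equivalent: (i) for every t > 0, ∫_0^t ∫_{ℝ^d} K(s,ξ) μ(dξ) ds < ∞; (ii) μ satisfies the Dalang condition ∫_{ℝ^d} (1+|ξ|²)^{-1} μ(dξ) < ∞. (The function K(s,ξ) is the squared modulus of the Fourier transform sin(s|ξ|)/|ξ| of the fundamental solution of the wave equation at time s.) -/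
open MeasureTheory
open scoped Classical

/-- `K(s,ξ)` is the squared modulus of the Fourier transform `sin(s|ξ|)/|ξ|`
of the fundamental solution of the wave equation at time `s`. -/
noncomputable def waveKernelSq (d : ℕ) (s : ℝ) (ξ : EuclideanSpace ℝ (Fin d)) : ℝ :=
  if ξ = 0 then s ^ 2 else (Real.sin (s * ‖ξ‖) / ‖ξ‖) ^ 2

lemma waveKernelSq_nonneg (d : ℕ) (s : ℝ) (ξ : EuclideanSpace ℝ (Fin d)) :
    0 ≤ waveKernelSq d s ξ := by
  unfold waveKernelSq
  split_ifs <;> positivity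

lemma measurable_waveKernelSq (d : ℕ) :
    Measurable (fun p : ℝ × EuclideanSpace ℝ (Fin d) => waveKernelSq d p.1 p.2) := by
  unfold waveKernelSq
  refine Measurable.ite (measurable_snd (measurableSet_singleton 0)) ?_ ?_ <;> fun_prop

lemma waveKernelSq_le (d : ℕ) (s : ℝ) (ξ : EuclideanSpace ℝ (Fin d)) :
    waveKernelSq d s ξ ≤ (1 + s ^ 2) * (1 / (1 + ‖ξ‖ ^ 2)) := by
  unfold waveKernelSq
  split_ifs with h
  · simp [h]
  · have hr : 0 < ‖ξ‖ := norm_pos_iff.mpr h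
    have h1 : Real.sin (s * ‖ξ‖) ^ 2 ≤ 1 := Real.sin_sq_le_one _
    have h2 : Real.sin (s * ‖ξ‖) ^ 2 ≤ (s * ‖ξ‖) ^ 2 := sq_le_sq.mpr Real.abs_sin_le_abs
    rw [div_pow, mul_one_div, div_le_div_iff₀ (by positivity) (by positivity)]
    nlinarith [mul_le_mul_of_nonneg_right h1 (sq_nonneg ‖ξ‖)]

lemma sq_div_four_le_waveKernelSq {d : ℕ} {s : ℝ} {ξ : EuclideanSpace ℝ (Fin d)}
    (hs : 0 ≤ s) (h : s * ‖ξ‖ ≤ 1) : s ^ 2 / 4 ≤ waveKernelSq d s ξ := by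
  unfold waveKernelSq
  split_ifs with h0
  · nlinarith [sq_nonneg s]
  · have hr : 0 < ‖ξ‖ := norm_pos_iff.mpr h0
    have hsr : 0 ≤ s * ‖ξ‖ := by positivity
    have h1 := Real.mul_le_sin hsr (by linarith [Real.pi_gt_three])
    have h2 : (1 / 2 : ℝ) ≤ 2 / Real.pi := by
      rw [div_le_div_iff₀ (by norm_num) Real.pi_pos]
      linarith [Real.pi_le_four]
    have h3 : s / 2 ≤ Real.sin (s * ‖ξ‖) / ‖ξ‖ := by
      rw [le_div_iff₀ hr]
      nlinarith [mul_le_mul_of_nonneg_right h2 hsr]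
    nlinarith

lemma inv_le_lintegral_waveKernelSq {d : ℕ} {ξ : EuclideanSpace ℝ (Fin d)} (h : 1 ≤ ‖ξ‖) :
    ENNReal.ofReal (1 / (1 + ‖ξ‖ ^ 2)) ≤
      4 * ∫⁻ s in Set.Ioc (0 : ℝ) 1, ENNReal.ofReal (waveKernelSq d s ξ) := by
  have hr : 0 < ‖ξ‖ := by linarith
  have hξ : ξ ≠ 0 := norm_pos_iff.mp hr
  have hK : ∀ s, waveKernelSq d s ξ = Real.sin (s * ‖ξ‖) ^ 2 / ‖ξ‖ ^ 2 := fun s => by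
    rw [waveKernelSq, if_neg hξ, div_pow]
  have hcont : Continuous fun s => waveKernelSq d s ξ := by
    simp_rw [hK]
    fun_prop
  rw [← ofReal_integral_eq_lintegral_ofReal
    (hcont.integrableOn_Ioc) (ae_of_all _ fun s => waveKernelSq_nonneg d s ξ),
    ← intervalIntegral.integral_of_le zero_le_one]
  simp_rw [hK]
  rw [intervalIntegral.integral_div,
    intervalIntegral.integral_comp_mul_right (fun x => Real.sin x ^ 2) hr.ne', integral_sin_sq,
    show (4 : ENNReal) = ENNReal.ofReal 4 by simp, ← ENNReal.ofReal_mul (by norm_num)]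
  apply ENNReal.ofReal_le_ofReal
  have h2 : 2 * Real.sin ‖ξ‖ * Real.cos ‖ξ‖ ≤ 1 := by
    rw [← Real.sin_two_mul]
    exact Real.sin_le_one _
  have h3 : 1 / 4 ≤ ‖ξ‖⁻¹ * ((‖ξ‖ - Real.sin ‖ξ‖ * Real.cos ‖ξ‖) / 2) := by
    rw [inv_mul_eq_div, le_div_iff₀ hr]
    linarith
  calc 1 / (1 + ‖ξ‖ ^ 2) ≤ 1 / ‖ξ‖ ^ 2 := by gcongr; linarith
    _ = 4 * (1 / 4 / ‖ξ‖ ^ 2) := by ring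
    _ ≤ _ := by
      gcongr
      simpa [neg_add_eq_sub] using h3

/-- The inner integral is finite at arbitrarily small times; no measurability in `s` is needed. -/
lemma measure_closedBall_lt_top_of_lintegral_waveKernelSq {d : ℕ}
    {μ : Measure (EuclideanSpace ℝ (Fin d))} {R : ℝ} (hR : 0 < R)
    (h : ∫⁻ s in Set.Ioc (0 : ℝ) R⁻¹, ∫⁻ ξ, ENNReal.ofReal (waveKernelSq d s ξ) ∂μ < ⊤) :
    μ (Metric.closedBall 0 R) < ⊤ := by
  obtain ⟨s, hs, hfin⟩ : ∃ s ∈ Set.Ioc (0 : ℝ) R⁻¹,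
      ∫⁻ ξ, ENNReal.ofReal (waveKernelSq d s ξ) ∂μ < ⊤ := by
    by_contra! hcon
    refine h.not_ge ?_
    calc (⊤ : ENNReal) = ∫⁻ _ in Set.Ioc (0 : ℝ) R⁻¹, ⊤ := by
          rw [setLIntegral_const, Real.volume_Ioc, ENNReal.top_mul]
          simpa using hR
      _ ≤ _ := setLIntegral_mono' measurableSet_Ioc hcon
  have hc : ENNReal.ofReal (s ^ 2 / 4) ≠ 0 := by
    have := hs.1
    simp only [ne_eq, ENNReal.ofReal_eq_zero, not_le]
    positivity
  have hle : ENNReal.ofReal (s ^ 2 / 4) * μ (Metric.closedBall 0 R) < ⊤ := by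
    rw [← setLIntegral_const]
    refine lt_of_le_of_lt ((setLIntegral_mono' Metric.isClosed_closedBall.measurableSet
      fun ξ hξ => ?_).trans (setLIntegral_le_lintegral _ _)) hfin
    refine ENNReal.ofReal_le_ofReal (sq_div_four_le_waveKernelSq hs.1.le ?_)
    rw [mem_closedBall_zero_iff] at hξ
    calc s * ‖ξ‖ ≤ R⁻¹ * R := by
          gcongr
          exact hs.2
      _ = 1 := inv_mul_cancel₀ hR.ne'
  by_contra! htop
  rw [top_le_iff.mp htop, ENNReal.mul_top hc] at hle
  exact lt_irrefl _ hle

/-- For a Borel measure `μ` on `ℝ^d`: `∫_0^t ∫ K(s,ξ) μ(dξ) ds < ∞` for all `t > 0`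
if and only if `μ` satisfies the Dalang condition `∫ (1+|ξ|²)^{-1} μ(dξ) < ∞`. -/
theorem stmt_4 (d : ℕ) (μ : Measure (EuclideanSpace ℝ (Fin d))) :
    (∀ t : ℝ, 0 < t →
      ∫⁻ s in Set.Ioc (0:ℝ) t,
        ∫⁻ ξ, ENNReal.ofReal (waveKernelSq d s ξ) ∂μ < ⊤) ↔
    ∫⁻ ξ, ENNReal.ofReal (1 / (1 + ‖ξ‖ ^ 2)) ∂μ < ⊤ := by
  constructor
  · intro h
    have hball : ∀ R : ℝ, 0 < R → μ (Metric.closedBall 0 R) < ⊤ := fun R hR =>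
      measure_closedBall_lt_top_of_lintegral_waveKernelSq hR (h _ (inv_pos.mpr hR))
    have : IsLocallyFiniteMeasure μ := ⟨fun x => ⟨Metric.closedBall 0 (‖x‖ + 1),
      Metric.closedBall_mem_nhds_of_mem (by simp), hball _ (by positivity)⟩⟩
    have hmeas := (measurable_waveKernelSq d).ennreal_ofReal
    have hswap := lintegral_lintegral_swap (μ := volume.restrict (Set.Ioc (0 : ℝ) 1)) (ν := μ)
      (f := fun s ξ => ENNReal.ofReal (waveKernelSq d s ξ)) hmeas.aemeasurable
    calc ∫⁻ ξ, ENNReal.ofReal (1 / (1 + ‖ξ‖ ^ 2)) ∂μ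
        ≤ ∫⁻ ξ, ((Metric.closedBall 0 1).indicator 1 ξ + 4 *
            ∫⁻ s in Set.Ioc (0 : ℝ) 1, ENNReal.ofReal (waveKernelSq d s ξ)) ∂μ := by
          refine lintegral_mono fun ξ => ?_
          rcases le_total ‖ξ‖ 1 with hξ | hξ
          · refine le_add_right ?_
            rw [Set.indicator_of_mem (mem_closedBall_zero_iff.mpr hξ), Pi.one_apply,
              ENNReal.ofReal_le_one]
            exact div_le_one_of_le₀ (by nlinarith [sq_nonneg ‖ξ‖]) (by positivity)
          · exact le_add_left (inv_le_lintegral_waveKernelSq hξ)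
      _ = μ (Metric.closedBall 0 1) + 4 * ∫⁻ s in Set.Ioc (0 : ℝ) 1,
            ∫⁻ ξ, ENNReal.ofReal (waveKernelSq d s ξ) ∂μ := by
          rw [lintegral_add_left (measurable_one.indicator
            Metric.isClosed_closedBall.measurableSet),
            lintegral_indicator_one Metric.isClosed_closedBall.measurableSet,
            lintegral_const_mul' _ _ (by simp), hswap]
      _ < ⊤ := ENNReal.add_lt_top.mpr ⟨hball 1 one_pos,
            ENNReal.mul_lt_top (by simp) (h 1 one_pos)⟩
  · intro h t ht
    calc ∫⁻ s in Set.Ioc (0 : ℝ) t, ∫⁻ ξ, ENNReal.ofReal (waveKernelSq d s ξ) ∂μ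
        ≤ ∫⁻ _ in Set.Ioc (0 : ℝ) t, ENNReal.ofReal (1 + t ^ 2) *
            ∫⁻ ξ, ENNReal.ofReal (1 / (1 + ‖ξ‖ ^ 2)) ∂μ := by
          refine setLIntegral_mono' measurableSet_Ioc fun s hs => ?_
          rw [← lintegral_const_mul' _ _ ENNReal.ofReal_ne_top]
          refine lintegral_mono fun ξ => ?_
          rw [← ENNReal.ofReal_mul (by positivity)]
          refine ENNReal.ofReal_le_ofReal ((waveKernelSq_le d s ξ).trans ?_)
          have := hs.1.le
          gcongr
          exact hs.2
      _ < ⊤ := by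
          rw [setLIntegral_const, Real.volume_Ioc]
          exact ENNReal.mul_lt_top (ENNReal.mul_lt_top ENNReal.ofReal_lt_top h)
            ENNReal.ofReal_lt_top
end

section
/- Let d ≥ 1 and 0 < β < d. Then there exists a constant c > 0 (depending only on β and d) such that for every complex-valued Schwartz function φ on ℝ^d, both integrals below are absolutely convergent and ∫_{ℝ^d} |ξ|^{-β} · 𝓕φ(ξ) dξ = c ∫_{ℝ^d} |x|^{β−d} · φ(x) dx. (Equivalently, the Fourier transform in the space of tempered distributions of the Riesz kernel x ↦ |x|^{β−d} is, up to a positive constant, the function ξ ↦ |ξ|^{-β}.) -/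
open MeasureTheory FourierTransform

section RieszKernel

variable {V : Type*} [NormedAddCommGroup V] [InnerProductSpace ℝ V] [FiniteDimensional ℝ V]
  [MeasurableSpace V] [BorelSpace V]

lemma SchwartzMap.integrable_rpow_neg_norm_mul (hV : 1 ≤ Module.finrank ℝ V) {α : ℝ} (hα0 : 0 ≤ α)
    (hα : α < Module.finrank ℝ V) (g : SchwartzMap V ℂ) :
    Integrable (fun x : V => ((‖x‖ ^ (-α) : ℝ) : ℂ) * g x) := by
  have hm : AEStronglyMeasurable (fun x : V => ((‖x‖ ^ (-α) : ℝ) : ℂ) * g x) := by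
    refine AEStronglyMeasurable.mul ?_ g.continuous.aestronglyMeasurable
    exact (Complex.measurable_ofReal.comp (measurable_norm.pow_const _)).aestronglyMeasurable
  have hn (x : V) : ‖((‖x‖ ^ (-α) : ℝ) : ℂ) * g x‖ = ‖x‖ ^ (-α) * ‖g x‖ := by
    rw [norm_mul, Complex.norm_real, Real.norm_of_nonneg (by positivity)]
  obtain ⟨C, -, hC⟩ := g.decay 0 0
  have hC' (x : V) : ‖g x‖ ≤ C := by simpa using hC x
  have h1 := integrableOn_ball_of_norm_le_rpow (μ := (volume : Measure V)) (r := 1) hV hα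
    (C := C) (ae_of_all _ fun x => by
      rw [hn, mul_comm]
      exact mul_le_mul_of_nonneg_right (hC' x) (by positivity)) hm
  have h2 : IntegrableOn (fun x : V => ((‖x‖ ^ (-α) : ℝ) : ℂ) * g x) (Metric.ball 0 1)ᶜ := by
    refine Integrable.mono' g.integrable.norm.integrableOn hm.restrict ?_
    refine (ae_restrict_iff' Metric.isOpen_ball.measurableSet.compl).2 (ae_of_all _ fun x hx => ?_)
    have hx1 : 1 ≤ ‖x‖ := by simpa using hx
    rw [hn]
    exact mul_le_of_le_one_left (norm_nonneg _)
      (Real.rpow_le_one_of_one_le_of_nonpos hx1 (by linarith))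
  rw [← integrableOn_univ, ← Set.union_compl_self (Metric.ball (0 : V) 1)]
  exact h1.union h2

lemma integral_rpow_mul_exp_neg_pi_mul_sq {a r : ℝ} (ha : 0 < a) (hr : 0 < r) :
    ∫ t in Set.Ioi (0 : ℝ), t ^ (a - 1) * Real.exp (-(Real.pi * r ^ 2 * t)) =
      Real.Gamma a / Real.pi ^ a * r ^ (-(2 * a)) := by
  rw [Real.integral_rpow_mul_exp_neg_mul_Ioi ha (by positivity), one_div,
    Real.inv_rpow (by positivity), Real.mul_rpow (by positivity) (by positivity),
    ← Real.rpow_natCast r 2, ← Real.rpow_mul hr.le, Real.rpow_neg hr.le]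
  push_cast
  field_simp

/-- Writing `‖x‖ ^ (-2a)` as a superposition of Gaussians. -/
lemma integral_integral_gaussian_mul [Nontrivial V] {a : ℝ} (ha : 0 < a) {g : V → ℂ}
    (hg : AEStronglyMeasurable g)
    (hi : Integrable (fun x : V => ((‖x‖ ^ (-(2 * a)) : ℝ) : ℂ) * g x)) :
    ∫ t in Set.Ioi (0 : ℝ), ((t ^ (a - 1) : ℝ) : ℂ) *
        ∫ x : V, (Real.exp (-(Real.pi * ‖x‖ ^ 2 * t)) : ℂ) * g x =
      ((Real.Gamma a / Real.pi ^ a : ℝ) : ℂ) * ∫ x : V, ((‖x‖ ^ (-(2 * a)) : ℝ) : ℂ) * g x := by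
  let F : V → ℝ → ℂ := fun x t =>
    ((t ^ (a - 1) * Real.exp (-(Real.pi * ‖x‖ ^ 2 * t)) : ℝ) : ℂ) * g x
  have hne : ∀ᵐ x : V, x ≠ 0 := by
    simp [ae_iff]
  have hker (x : V) (hx : x ≠ 0) : IntegrableOn
      (fun t : ℝ => t ^ (a - 1) * Real.exp (-(Real.pi * ‖x‖ ^ 2 * t))) (Set.Ioi 0) := by
    have hx' : 0 < ‖x‖ := norm_pos_iff.2 hx
    have := integrableOn_rpow_mul_exp_neg_mul_rpow (s := a - 1) (p := 1)
      (b := Real.pi * ‖x‖ ^ 2) (by linarith) one_pos (by positivity)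
    simpa using this
  have hFm : AEStronglyMeasurable (Function.uncurry F)
      ((volume : Measure V).prod (volume.restrict (Set.Ioi (0 : ℝ)))) := by
    refine AEStronglyMeasurable.mul ?_ hg.comp_fst
    exact Measurable.aestronglyMeasurable (by fun_prop)
  have hFi : Integrable (Function.uncurry F)
      ((volume : Measure V).prod (volume.restrict (Set.Ioi (0 : ℝ)))) := by
    rw [integrable_prod_iff hFm]
    refine ⟨?_, ?_⟩
    · filter_upwards [hne] with x hx
      exact ((hker x hx).ofReal (𝕜 := ℂ)).mul_const (g x)
    · refine (hi.norm.const_mul (Real.Gamma a / Real.pi ^ a)).congr ?_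
      filter_upwards [hne] with x hx
      have : ∫ t in Set.Ioi (0 : ℝ), ‖F x t‖ = ∫ t in Set.Ioi (0 : ℝ),
          (t ^ (a - 1) * Real.exp (-(Real.pi * ‖x‖ ^ 2 * t))) * ‖g x‖ := by
        refine setIntegral_congr_fun measurableSet_Ioi fun t (ht : 0 < t) => ?_
        simp only [F]
        rw [norm_mul, Complex.norm_real, Real.norm_of_nonneg (by positivity)]
      simp only [Function.uncurry_apply_pair]
      rw [this, integral_mul_const, integral_rpow_mul_exp_neg_pi_mul_sq ha (norm_pos_iff.2 hx),
        norm_mul, Complex.norm_real, Real.norm_of_nonneg (by positivity), mul_assoc]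
  calc
    _ = ∫ t in Set.Ioi (0 : ℝ), ∫ x : V, F x t := by
      refine setIntegral_congr_fun measurableSet_Ioi fun t _ => ?_
      simp only [F]
      rw [← integral_const_mul]
      congr 1 with x
      push_cast
      ring
    _ = ∫ x : V, ∫ t in Set.Ioi (0 : ℝ), F x t := (integral_integral_swap hFi).symm
    _ = _ := by
      rw [← integral_const_mul]
      refine integral_congr_ae ?_
      filter_upwards [hne] with x hx
      simp only [F]
      rw [integral_mul_const, integral_complex_ofReal,
        integral_rpow_mul_exp_neg_pi_mul_sq ha (norm_pos_iff.2 hx)]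
      push_cast
      ring

lemma integral_gaussian_mul_fourier {f : V → ℂ} (hf : Integrable f) {t : ℝ} (ht : 0 < t) :
    ∫ ξ : V, (Real.exp (-(Real.pi * ‖ξ‖ ^ 2 * t)) : ℂ) * 𝓕 f ξ =
      ((t ^ (-(Module.finrank ℝ V / 2 : ℝ)) : ℝ) : ℂ) *
        ∫ x : V, (Real.exp (-(Real.pi * ‖x‖ ^ 2 * t⁻¹)) : ℂ) * f x := by
  have hb : 0 < ((Real.pi * t : ℝ) : ℂ).re := by
    rw [Complex.ofReal_re]; positivity
  have hG : Integrable (fun v : V => Complex.exp (-((Real.pi * t : ℝ) : ℂ) * ‖v‖ ^ 2)) := by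
    simpa using GaussianFourier.integrable_cexp_neg_mul_sq_norm_add hb 0 (0 : V)
  have key : ∫ w : V, 𝓕 (fun v : V => Complex.exp (-((Real.pi * t : ℝ) : ℂ) * ‖v‖ ^ 2)) w * f w =
      ∫ w : V, Complex.exp (-((Real.pi * t : ℝ) : ℂ) * ‖w‖ ^ 2) * 𝓕 f w := by
    simpa using! VectorFourier.integral_fourierIntegral_smul_eq_flip (L := innerₗ V)
      Real.continuous_fourierChar continuous_inner hG hf
  calc
    _ = ∫ w : V, Complex.exp (-((Real.pi * t : ℝ) : ℂ) * ‖w‖ ^ 2) * 𝓕 f w := by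
      congr 1 with w
      push_cast
      ring_nf
    _ = _ := by
      rw [← key, ← integral_const_mul]
      congr 1 with w
      rw [fourier_gaussian_innerProductSpace hb, ← mul_assoc]
      have hpi : (Real.pi : ℂ) ≠ 0 := by exact_mod_cast Real.pi_ne_zero
      have ht' : (t : ℂ) ≠ 0 := by exact_mod_cast ht.ne'
      congr 2
      · rw [Real.rpow_neg ht.le, ← Real.inv_rpow ht.le, Complex.ofReal_cpow (by positivity)]
        push_cast
        congr 1
        field_simp
      · push_cast
        congr 1
        field_simp

lemma setIntegral_Ioi_rpow_mul_comp_inv (a : ℝ) (J : ℝ → ℂ) :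
    ∫ t in Set.Ioi (0 : ℝ), ((t ^ (-a - 1) : ℝ) : ℂ) * J t⁻¹ =
      ∫ s in Set.Ioi (0 : ℝ), ((s ^ (a - 1) : ℝ) : ℂ) * J s := by
  rw [← integral_comp_rpow_Ioi (fun s => ((s ^ (a - 1) : ℝ) : ℂ) * J s) (p := -1) (by norm_num)]
  refine setIntegral_congr_fun measurableSet_Ioi fun t (ht : 0 < t) => ?_
  simp only [Complex.real_smul]
  rw [← mul_assoc, ← Complex.ofReal_mul, Real.rpow_neg_one, Real.inv_rpow ht.le,
    ← Real.rpow_neg ht.le, abs_neg, abs_one, one_mul, ← Real.rpow_add ht]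
  ring_nf

end RieszKernel

/-- For `0 < β < d`, the Fourier transform (in the space of tempered distributions) of the
Riesz kernel `x ↦ |x|^{β−d}` on `ℝ^d` is, up to a positive constant, the function
`ξ ↦ |ξ|^{-β}`: there is `c > 0` such that for every complex Schwartz function `φ`,
`∫ |ξ|^{-β} 𝓕φ(ξ) dξ = c ∫ |x|^{β−d} φ(x) dx`, both integrals converging absolutely. -/
theorem stmt_15 (d : ℕ) (hd : 1 ≤ d) (β : ℝ) (hβ0 : 0 < β) (hβd : β < d) :
    ∃ c : ℝ, 0 < c ∧ ∀ φ : SchwartzMap (EuclideanSpace ℝ (Fin d)) ℂ,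
      Integrable (fun ξ : EuclideanSpace ℝ (Fin d) => ((‖ξ‖ ^ (-β) : ℝ) : ℂ) * 𝓕 (⇑φ) ξ) ∧
      Integrable (fun x : EuclideanSpace ℝ (Fin d) => ((‖x‖ ^ (β - d) : ℝ) : ℂ) * φ x) ∧
      ∫ ξ : EuclideanSpace ℝ (Fin d), ((‖ξ‖ ^ (-β) : ℝ) : ℂ) * 𝓕 (⇑φ) ξ =
        (c : ℂ) * ∫ x : EuclideanSpace ℝ (Fin d), ((‖x‖ ^ (β - (d : ℝ)) : ℝ) : ℂ) * φ x := by
  have hfr : Module.finrank ℝ (EuclideanSpace ℝ (Fin d)) = d := by simp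
  have : Nontrivial (EuclideanSpace ℝ (Fin d)) :=
    Module.nontrivial_of_finrank_pos (R := ℝ) (by omega)
  have ha : 0 < β / 2 := by positivity
  have hb : 0 < (d - β) / 2 := by linarith
  have hΓa := Real.Gamma_pos_of_pos ha
  have hΓb := Real.Gamma_pos_of_pos hb
  refine ⟨(Real.Gamma (β / 2) / Real.pi ^ (β / 2))⁻¹ *
    (Real.Gamma ((d - β) / 2) / Real.pi ^ ((d - β) / 2)), by positivity, fun φ => ?_⟩
  have h1 : Integrable (fun ξ : EuclideanSpace ℝ (Fin d) =>
      ((‖ξ‖ ^ (-β) : ℝ) : ℂ) * 𝓕 (⇑φ) ξ) :=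
    (𝓕 φ).integrable_rpow_neg_norm_mul (by omega) hβ0.le (by rwa [hfr])
  have h2 : Integrable (fun x : EuclideanSpace ℝ (Fin d) =>
      ((‖x‖ ^ (β - d) : ℝ) : ℂ) * φ x) := by
    simpa using φ.integrable_rpow_neg_norm_mul (α := d - β) (by omega) (by linarith)
      (by rw [hfr]; linarith)
  refine ⟨h1, h2, ?_⟩
  have ea : -β = -(2 * (β / 2)) := by ring
  have eb : β - d = -(2 * ((d - β) / 2)) := by ring
  rw [ea] at h1 ⊢
  rw [eb] at h2 ⊢
  have i1 := integral_integral_gaussian_mul ha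
    ((𝓕 φ).continuous.aestronglyMeasurable) h1
  have i2 := integral_integral_gaussian_mul hb φ.continuous.aestronglyMeasurable h2
  have i3 : (∫ t in Set.Ioi (0 : ℝ), ((t ^ (β / 2 - 1) : ℝ) : ℂ) *
        ∫ ξ : EuclideanSpace ℝ (Fin d),
          (Real.exp (-(Real.pi * ‖ξ‖ ^ 2 * t)) : ℂ) * 𝓕 (⇑φ) ξ) =
      ∫ s in Set.Ioi (0 : ℝ), ((s ^ ((d - β) / 2 - 1) : ℝ) : ℂ) *
        ∫ x : EuclideanSpace ℝ (Fin d), (Real.exp (-(Real.pi * ‖x‖ ^ 2 * s)) : ℂ) * φ x := by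
    rw [← setIntegral_Ioi_rpow_mul_comp_inv ((d - β) / 2)]
    refine setIntegral_congr_fun measurableSet_Ioi fun t (ht : 0 < t) => ?_
    rw [integral_gaussian_mul_fourier φ.integrable ht, ← mul_assoc, ← Complex.ofReal_mul,
      ← Real.rpow_add ht, hfr,
      show β / 2 - 1 + -((d : ℝ) / 2) = -((d - β) / 2) - 1 by ring]
  have i4 := (i1.symm.trans i3).trans i2
  have hA : ((Real.Gamma (β / 2) / Real.pi ^ (β / 2) : ℝ) : ℂ) ≠ 0 := by
    exact_mod_cast (by positivity : Real.Gamma (β / 2) / Real.pi ^ (β / 2) ≠ 0)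
  rw [Complex.ofReal_mul, Complex.ofReal_inv, mul_assoc, ← i4, inv_mul_cancel_left₀ hA]
end
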